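/- The Prime Number Theorem in logarithmic-integral form: π(x) / (∫_2^x dt/log t) → 1 as x → ∞, where π(x) is the number of primes ≤ x. -/

import Mathlib

open Filter
open MeasureTheory Topology Asymptotics
open scoped FourierTransform ContDiff ArithmeticFunction.vonMangoldt

theorem fourier_modulate (h : ℝ → ℂ) (y u : ℝ) :
    𝓕 (fun ξ : ℝ ↦ (𝐞 (ξ * y) : ℂ) * h ξ) u = 𝓕 h (u - y) := by
  rw [Real.fourier_real_eq, Real.fourier_real_eq]
  refine integral_congr_ae (.of_forall fun v ↦ ?_)
  simp only [Circle.smul_def, smul_eq_mul, ← mul_assoc, ← Circle.coe_mul, ← AddChar.map_add_eq_mul]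
  ring_nf

theorem integral_fourier_mul_eq_integral_mul_fourier {f g : ℝ → ℂ} (hf : Integrable f)
    (hg : Integrable g) : ∫ ξ, 𝓕 f ξ * g ξ = ∫ x, f x * 𝓕 g x := by
  have := VectorFourier.integral_fourierIntegral_smul_eq_flip (μ := volume) (ν := volume)
    (L := innerₗ ℝ) Real.continuous_fourierChar continuous_inner hf hg
  simpa only [smul_eq_mul, flip_innerₗ] using! this

/-- If the one-sided Laplace transform of a bounded function extends continuously to the closed
right half plane, then the averages of the function against translates of an integrable kernel
with compactly supported Fourier transform tend to zero. -/
theorem tendsto_integral_mul_fourier_sub {b : ℝ → ℂ} {C : ℝ} {G : ℂ → ℂ} {h : ℝ → ℂ}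
    (hb : Measurable b) (hbC : ∀ u, ‖b u‖ ≤ C) (hb0 : ∀ u < 0, b u = 0)
    (hG : ContinuousOn G {s | 0 ≤ s.re})
    (hbG : ∀ σ : ℝ, 0 < σ → ∀ ξ : ℝ,
      𝓕 (fun u : ℝ ↦ (Real.exp (-σ * u) : ℂ) * b u) ξ = G (σ + 2 * Real.pi * ξ * Complex.I))
    (hh : Continuous h) (hhc : HasCompactSupport h) (hFh : Integrable (𝓕 h)) :
    Tendsto (fun y : ℝ ↦ ∫ u, b u * 𝓕 h (u - y)) atTop (𝓝 0) := by
  have hexp (σ : ℝ) (hσ : 0 ≤ σ) (u : ℝ) : ‖(Real.exp (-σ * u) : ℂ) * b u‖ ≤ ‖b u‖ := by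
    rcases lt_or_ge u 0 with hu | hu
    · simp [hb0 u hu]
    · rw [norm_mul, Complex.norm_real, Real.norm_of_nonneg (Real.exp_pos _).le]
      exact mul_le_of_le_one_left (norm_nonneg _) (Real.exp_le_one_iff.2 (by nlinarith))
  have hmeas (σ : ℝ) : Measurable (fun u : ℝ ↦ (Real.exp (-σ * u) : ℂ) * b u) := by fun_prop
  have hint (σ : ℝ) (hσ : 0 < σ) : Integrable (fun u : ℝ ↦ (Real.exp (-σ * u) : ℂ) * b u) := by
    have : Integrable ((Set.Ioi (0 : ℝ)).indicator fun u ↦ Real.exp (-σ * u) * C) :=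
      (integrable_indicator_iff measurableSet_Ioi).2
        ((integrableOn_exp_mul_Ioi (neg_lt_zero.2 hσ) 0).mul_const C)
    have h0 : ∀ᵐ u : ℝ, u ≠ 0 := by simp [ae_iff]
    refine this.mono' (hmeas σ).aestronglyMeasurable (h0.mono fun u hu0 ↦ ?_)
    rcases lt_or_gt_of_ne hu0 with hu | hu
    · simp [hb0 u hu, hu.le]
    · rw [Set.indicator_of_mem (Set.mem_Ioi.2 hu), norm_mul, Complex.norm_real,
        Real.norm_of_nonneg (Real.exp_pos _).le]
      gcongr
      exact hbC u
  have key (y : ℝ) : ∫ u, b u * 𝓕 h (u - y) =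
      𝓕 (fun ξ : ℝ ↦ G (2 * Real.pi * ξ * Complex.I) * h ξ) (-y) := by
    have e1 (σ : ℝ) (hσ : 0 < σ) :
        ∫ ξ : ℝ, G (σ + 2 * Real.pi * ξ * Complex.I) * ((𝐞 (ξ * y) : ℂ) * h ξ) =
          ∫ u, ((Real.exp (-σ * u) : ℂ) * b u) * 𝓕 h (u - y) := by
      have hi : Integrable (fun ξ : ℝ ↦ (𝐞 (ξ * y) : ℂ) * h ξ) := by
        apply Continuous.integrable_of_hasCompactSupport
        · fun_prop
        · exact hhc.mul_left
      have := integral_fourier_mul_eq_integral_mul_fourier (hint σ hσ) hi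
      simpa only [hbG σ hσ, fourier_modulate] using this
    have t1 : Tendsto (fun σ : ℝ ↦ ∫ u, ((Real.exp (-σ * u) : ℂ) * b u) * 𝓕 h (u - y))
        (𝓝[>] 0) (𝓝 (∫ u, b u * 𝓕 h (u - y))) := by
      refine tendsto_integral_filter_of_dominated_convergence (fun u ↦ C * ‖𝓕 h (u - y)‖)
        ?_ ?_ ?_ ?_
      · exact .of_forall fun σ ↦ (hmeas σ).aestronglyMeasurable.mul
          (hFh.comp_sub_right y).aestronglyMeasurable
      · filter_upwards [self_mem_nhdsWithin] with σ hσ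
        refine .of_forall fun u ↦ ?_
        rw [norm_mul]
        gcongr
        exact (hexp σ (le_of_lt hσ) u).trans (hbC u)
      · exact (hFh.comp_sub_right y).norm.const_mul C
      · refine .of_forall fun u ↦ ?_
        have : Continuous fun σ : ℝ ↦ ((Real.exp (-σ * u) : ℂ) * b u) * 𝓕 h (u - y) := by fun_prop
        simpa using (this.tendsto 0).mono_left nhdsWithin_le_nhds
    have t2 : Tendsto
        (fun σ : ℝ ↦ ∫ ξ : ℝ, G (σ + 2 * Real.pi * ξ * Complex.I) * ((𝐞 (ξ * y) : ℂ) * h ξ))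
        (𝓝[>] 0) (𝓝 (∫ ξ : ℝ, G (2 * Real.pi * ξ * Complex.I) * ((𝐞 (ξ * y) : ℂ) * h ξ))) := by
      have hGc : ContinuousOn (fun p : ℝ × ℝ ↦ G (p.1 + 2 * Real.pi * p.2 * Complex.I))
          (Set.Ici 0 ×ˢ Set.univ) := by
        refine hG.comp (by fun_prop) fun p hp ↦ ?_
        simpa using hp.1
      obtain ⟨M, hM⟩ := ((isCompact_Icc (a := (0 : ℝ)) (b := 1)).prod
        hhc.isCompact).exists_bound_of_continuousOn
          (hGc.mono (Set.prod_mono Set.Icc_subset_Ici_self (Set.subset_univ _)))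
      refine tendsto_integral_filter_of_dominated_convergence (fun ξ ↦ M * ‖h ξ‖) ?_ ?_ ?_ ?_
      · filter_upwards [self_mem_nhdsWithin] with σ hσ
        refine (Continuous.mul ?_ (by fun_prop)).aestronglyMeasurable
        exact hGc.comp_continuous (f := fun ξ : ℝ ↦ (σ, ξ)) (by fun_prop)
          fun ξ ↦ ⟨Set.Ioi_subset_Ici_self hσ, trivial⟩
      · filter_upwards [Ioc_mem_nhdsGT (zero_lt_one' ℝ)] with σ hσ
        refine .of_forall fun ξ ↦ ?_
        by_cases hξ : h ξ = 0
        · simp [hξ]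
        · rw [norm_mul, norm_mul, Circle.norm_coe, one_mul]
          gcongr
          exact hM (σ, ξ) ⟨⟨hσ.1.le, hσ.2⟩, subset_tsupport h hξ⟩
      · exact (hh.integrable_of_hasCompactSupport hhc).norm.const_mul M
      · refine .of_forall fun ξ ↦ Tendsto.mul_const _ ?_
        have : ContinuousOn (fun σ : ℝ ↦ G (σ + 2 * Real.pi * ξ * Complex.I)) (Set.Ici 0) :=
          hGc.comp (f := fun σ : ℝ ↦ (σ, ξ)) (by fun_prop) fun σ hσ ↦ ⟨hσ, trivial⟩
        simpa using (this 0 Set.self_mem_Ici).mono_left (nhdsWithin_mono _ Set.Ioi_subset_Ici_self)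
    rw [tendsto_nhds_unique t1 (t2.congr' (eventually_nhdsWithin_of_forall e1)),
      Real.fourier_real_eq]
    refine integral_congr_ae (.of_forall fun ξ ↦ ?_)
    simp only [Circle.smul_def, smul_eq_mul, mul_neg, neg_neg]
    ring
  simp_rw [key]
  exact (Real.zero_at_infty_fourier _).comp (tendsto_neg_atTop_atBot.mono_right
    atBot_le_cocompact)

/-- There is a continuous compactly supported function whose Fourier transform is nonnegative,
integrable and not identically zero. -/
theorem exists_hasCompactSupport_fourier_nonneg :
    ∃ (h : ℝ → ℂ) (K : ℝ → ℝ), Continuous h ∧ HasCompactSupport h ∧ (∀ ξ, 𝓕 h ξ = K ξ) ∧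
      (∀ ξ, 0 ≤ K ξ) ∧ Integrable K ∧ 0 < ∫ ξ, K ξ := by
  let φ : ContDiffBump (0 : ℝ) := default
  let f : ℝ → ℂ := fun x ↦ (φ x : ℂ)
  have hf : ContDiff ℝ ∞ f := Complex.ofRealCLM.contDiff.comp φ.contDiff
  have hfc : HasCompactSupport f := φ.hasCompactSupport.comp_left (g := ((↑) : ℝ → ℂ)) (by simp)
  have hfi : Integrable f := hf.continuous.integrable_of_hasCompactSupport hfc
  let F : SchwartzMap ℝ ℂ := 𝓕 (hfc.toSchwartzMap hf)
  have hF : ⇑F = 𝓕 f := SchwartzMap.fourier_coe _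
  have hreal (ξ : ℝ) : 𝓕 f ξ = ((𝓕 f ξ).re : ℂ) := by
    refine (Complex.conj_eq_iff_re.1 ?_).symm
    rw [Real.fourier_real_eq, ← integral_conj, ← integral_neg_eq_self]
    refine integral_congr_ae (.of_forall fun v ↦ ?_)
    simp [f, Circle.smul_def, φ.neg, ← Circle.coe_inv_eq_conj, ← AddChar.map_neg_eq_inv]
  have hconv : ∀ ξ, 𝓕 (convolution f f (ContinuousLinearMap.mul ℂ ℂ) volume) ξ =
      (((𝓕 f ξ).re ^ 2 : ℝ) : ℂ) := fun ξ ↦ by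
    rw [Real.fourier_mul_convolution_eq hfi hfi, hreal ξ]
    push_cast
    simp [sq]
  have hcont : Continuous fun ξ ↦ (𝓕 f ξ).re ^ 2 := by
    rw [← hF]; fun_prop
  have hint : Integrable fun ξ ↦ (𝓕 f ξ).re ^ 2 := by
    rw [← hF]
    have := (F.memLp 2 volume).integrable_norm_pow (by norm_num)
    refine this.mono' ?_ ?_
    · exact (by fun_prop : Continuous fun ξ ↦ (F ξ).re ^ 2).aestronglyMeasurable
    · refine .of_forall fun ξ ↦ ?_
      rw [norm_pow]
      gcongr
      exact Complex.abs_re_le_norm _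
  refine ⟨convolution f f (ContinuousLinearMap.mul ℂ ℂ) volume, fun ξ ↦ (𝓕 f ξ).re ^ 2, ?_, ?_,
    hconv, fun ξ ↦ sq_nonneg _, hint, ?_⟩
  · exact hfc.continuous_convolution_right _ hfi.locallyIntegrable hf.continuous
  · exact hfc.convolution _ hfc
  · refine integral_pos_of_integrable_nonneg_nonzero (x := 0) hcont hint (fun ξ ↦ sq_nonneg _) ?_
    have h0 : 𝓕 f 0 = ((∫ x, φ x : ℝ) : ℂ) := by
      simp [Real.fourier_real_eq, f, integral_complex_ofReal]
    rw [h0, Complex.ofReal_re]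
    exact pow_ne_zero 2 φ.integral_pos.ne'

theorem fourier_comp_div (h : ℝ → ℂ) {r : ℝ} (hr : 0 < r) (u : ℝ) :
    𝓕 (fun ξ ↦ h (ξ / r)) u = r * 𝓕 h (r * u) := by
  have := Measure.integral_comp_div (fun v : ℝ ↦ 𝐞 (-(v * (r * u))) • h v) r
  rw [Real.fourier_real_eq, Real.fourier_real_eq, ← Complex.real_smul]
  rw [abs_of_pos hr] at this
  rw [← this]
  refine integral_congr_ae (.of_forall fun v ↦ ?_)
  beta_reduce
  rw [show v / r * (r * u) = v * u by field_simp]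

/-- There are probability densities, concentrated near zero, whose Fourier transform is compactly
supported. -/
theorem exists_hasCompactSupport_fourier_concentrated {δ ε : ℝ} (hδ : 0 < δ) (hε : 0 < ε) :
    ∃ (h : ℝ → ℂ) (K : ℝ → ℝ), Continuous h ∧ HasCompactSupport h ∧ (∀ ξ, 𝓕 h ξ = K ξ) ∧
      (∀ ξ, 0 ≤ K ξ) ∧ Integrable K ∧ ∫ ξ, K ξ = 1 ∧ 1 - ε < ∫ ξ in Set.Icc (-δ) δ, K ξ := by
  obtain ⟨h, K, hh, hhc, hK, hK0, hKi, hKpos⟩ := exists_hasCompactSupport_fourier_nonneg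
  set κ := ∫ ξ, K ξ with hκ
  have hlim : Tendsto (fun r : ℝ ↦ κ⁻¹ * ∫ ξ in (r * -δ)..(r * δ), K ξ) atTop (𝓝 (κ⁻¹ * κ)) :=
    (intervalIntegral_tendsto_integral hKi (tendsto_id.atTop_mul_const_of_neg (by linarith))
      (tendsto_id.atTop_mul_const hδ)).const_mul _
  rw [inv_mul_cancel₀ hKpos.ne'] at hlim
  obtain ⟨r, hr, hr0⟩ :=
    ((hlim.eventually_const_lt (show 1 - ε < 1 by linarith)).and (eventually_gt_atTop 0)).exists
  refine ⟨fun ξ ↦ (κ⁻¹ : ℂ) * h (ξ / r), fun ξ ↦ κ⁻¹ * (r * K (r * ξ)), by fun_prop, ?_, ?_, ?_, ?_,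
    ?_, ?_⟩
  · refine HasCompactSupport.mul_left ?_
    simpa only [div_eq_mul_inv] using!
      hhc.comp_homeomorph (Homeomorph.mulRight₀ r⁻¹ (inv_ne_zero hr0.ne'))
  · intro ξ
    have := fourier_comp_div h hr0 ξ
    rw [hK, Real.fourier_real_eq] at this
    rw [Real.fourier_real_eq]
    simp_rw [Circle.smul_def, smul_eq_mul] at this ⊢
    simp_rw [mul_left_comm _ (κ⁻¹ : ℂ)]
    rw [integral_const_mul, this]
    push_cast
    rfl
  · intro ξ
    have := hK0 (r * ξ)
    positivity
  · exact ((hKi.comp_mul_left' hr0.ne').const_mul r).const_mul _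
  · rw [integral_const_mul, integral_const_mul, Measure.integral_comp_mul_left,
      abs_of_pos (inv_pos.2 hr0), smul_eq_mul, mul_inv_cancel_left₀ hr0.ne',
      inv_mul_cancel₀ hKpos.ne']
  · rw [integral_Icc_eq_integral_Ioc, ← intervalIntegral.integral_of_le (by linarith),
      intervalIntegral.integral_const_mul, intervalIntegral.integral_const_mul,
      intervalIntegral.mul_integral_comp_mul_left]
    exact hr

theorem setIntegral_comp_sub_Icc (K : ℝ → ℝ) (y δ : ℝ) :
    ∫ u in Set.Icc (y - δ) (y + δ), K (u - y) = ∫ u in Set.Icc (-δ) δ, K u := by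
  have := (measurePreserving_sub_right volume y).setIntegral_preimage_emb
    (MeasurableEquiv.subRight y).measurableEmbedding K (Set.Icc (-δ) δ)
  rw [← this]
  congr 2
  ext u
  simp only [Set.mem_Icc, Set.mem_preimage]
  constructor <;> rintro ⟨_, _⟩ <;> constructor <;> linarith

section Tauberian

variable {a : ℝ → ℝ} {C : ℝ}

/-- Averaging `a - 1` over a concentrated kernel, when `a u * exp u` is increasing. -/
theorem le_integral_kernel_of_monotone (ha0 : ∀ u, 0 ≤ a u) (haC : ∀ u, a u ≤ C)
    (ham : Monotone fun u ↦ a u * Real.exp u) {b K : ℝ → ℝ} {δ y : ℝ}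
    (hb : ∀ u, 0 ≤ u → b u = a u - 1) (hb0 : ∀ u < 0, b u = 0) (hbm : Measurable b)
    (hK0 : ∀ u, 0 ≤ K u) (hKi : Integrable K) (hK1 : ∫ u, K u = 1) (hy : δ ≤ y) :
    a (y - δ) * Real.exp (-(2 * δ)) * (∫ u in Set.Icc (-δ) δ, K u) - 1 ≤ ∫ u, b u * K (u - y) ∧
    ∫ u, b u * K (u - y) ≤ a (y + δ) * Real.exp (2 * δ) - 1 +
      (C + 1) * (1 - ∫ u in Set.Icc (-δ) δ, K u) := by
  have ha : ∀ u v, u ≤ v → a u * Real.exp (u - v) ≤ a v := fun u v huv ↦ by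
    have := ham huv
    rw [Real.exp_sub, ← mul_div_assoc, div_le_iff₀ (Real.exp_pos _)]
    exact this
  have hC : 0 ≤ C := (ha0 0).trans (haC 0)
  have hb_ge : ∀ u, -1 ≤ b u := fun u ↦ by
    rcases lt_or_ge u 0 with hu | hu
    · simp [hb0 u hu]
    · linarith [hb u hu, ha0 u]
  have hb_le : ∀ u, b u ≤ C := fun u ↦ by
    rcases lt_or_ge u 0 with hu | hu
    · simpa [hb0 u hu] using hC
    · linarith [hb u hu, haC u]
  let I := Set.Icc (y - δ) (y + δ)
  have hKy : Integrable fun u ↦ K (u - y) := hKi.comp_sub_right y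
  have hKy1 : ∫ u, K (u - y) = 1 := by rw [integral_sub_right_eq_self, hK1]
  have hint : Integrable fun u ↦ b u * K (u - y) :=
    hKy.bdd_mul (c := C + 1) hbm.aestronglyMeasurable
      (.of_forall fun u ↦ abs_le.2 ⟨by linarith [hb_ge u], by linarith [hb_le u]⟩)
  have hKI : Integrable (I.indicator fun u ↦ K (u - y)) := hKy.indicator measurableSet_Icc
  have hKd : Integrable fun u ↦ K (u - y) - I.indicator (fun u ↦ K (u - y)) u := hKy.sub hKI
  have hKI1 : ∫ u, I.indicator (fun u ↦ K (u - y)) u = ∫ u in Set.Icc (-δ) δ, K u := by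
    rw [integral_indicator measurableSet_Icc, setIntegral_comp_sub_Icc]
  constructor
  · have h1 : ∫ u, (a (y - δ) * Real.exp (-(2 * δ)) * I.indicator (fun u ↦ K (u - y)) u -
        K (u - y)) = a (y - δ) * Real.exp (-(2 * δ)) * (∫ u in Set.Icc (-δ) δ, K u) - 1 := by
      rw [integral_sub (hKI.const_mul _) hKy, integral_const_mul, hKI1, hKy1]
    rw [← h1]
    refine integral_mono ((hKI.const_mul _).sub hKy) hint fun u ↦ ?_
    by_cases hu : u ∈ I
    · have h2 := ha (y - δ) u hu.1
      have h3 : a (y - δ) * Real.exp (-(2 * δ)) ≤ a (y - δ) * Real.exp (y - δ - u) := by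
        gcongr
        · exact ha0 _
        · linarith [hu.2]
      have h4 := hb u (by linarith [hu.1])
      simp only [Set.indicator_of_mem hu]
      rw [← sub_one_mul]
      exact mul_le_mul_of_nonneg_right (by linarith) (hK0 _)
    · simp only [Set.indicator_of_notMem hu]
      nlinarith [hb_ge u, hK0 (u - y)]
  · have h1 : ∫ u, ((a (y + δ) * Real.exp (2 * δ) - 1) * K (u - y) +
        (C + 1) * (K (u - y) - I.indicator (fun u ↦ K (u - y)) u)) =
        a (y + δ) * Real.exp (2 * δ) - 1 + (C + 1) * (1 - ∫ u in Set.Icc (-δ) δ, K u) := by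
      rw [integral_add (hKy.const_mul _) (hKd.const_mul _), integral_const_mul,
        integral_const_mul, integral_sub hKy hKI, hKI1, hKy1, mul_one]
    rw [← h1]
    refine integral_mono hint ((hKy.const_mul _).add (hKd.const_mul _)) fun u ↦ ?_
    have hA : 0 ≤ a (y + δ) * Real.exp (2 * δ) := mul_nonneg (ha0 _) (Real.exp_pos _).le
    by_cases hu : u ∈ I
    · have h2 := ha u (y + δ) hu.2
      have h3 : a u ≤ a (y + δ) * Real.exp (2 * δ) := by
        calc a u = a u * Real.exp (u - (y + δ)) * Real.exp (y + δ - u) := by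
              rw [mul_assoc, ← Real.exp_add]; simp
          _ ≤ a (y + δ) * Real.exp (2 * δ) := by
              gcongr
              · exact ha0 _
              · linarith [hu.1]
      have h4 := hb u (by linarith [hu.1])
      simp only [Set.indicator_of_mem hu, sub_self, mul_zero, add_zero]
      exact mul_le_mul_of_nonneg_right (by linarith) (hK0 _)
    · simp only [Set.indicator_of_notMem hu, sub_zero]
      rw [← add_mul]
      exact mul_le_mul_of_nonneg_right (by linarith [hb_le u]) (hK0 _)

/-- A Tauberian theorem: if `a u * exp u` is increasing and the smooth averages of `a - 1` tend to
zero, then `a` tends to `1`. -/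
theorem tendsto_one_of_integral_fourier_kernel (ha0 : ∀ u, 0 ≤ a u) (haC : ∀ u, a u ≤ C)
    (ham : Monotone fun u ↦ a u * Real.exp u) {b : ℝ → ℝ}
    (hb : ∀ u, 0 ≤ u → b u = a u - 1) (hb0 : ∀ u < 0, b u = 0) (hbm : Measurable b)
    (hlim : ∀ h : ℝ → ℂ, Continuous h → HasCompactSupport h → Integrable (𝓕 h) →
      Tendsto (fun y : ℝ ↦ ∫ u, (b u : ℂ) * 𝓕 h (u - y)) atTop (𝓝 0)) :
    Tendsto a atTop (𝓝 1) := by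
  have hC : 0 ≤ C := (ha0 0).trans (haC 0)
  have step (ε : ℝ) (hε : 0 < ε) (hε1 : ε < 1) : ∀ᶠ z in atTop,
      a z ≤ Real.exp (2 * ε) * (1 + ε) / (1 - ε) ∧
      (1 - (C + 2) * ε) * Real.exp (-(2 * ε)) ≤ a z := by
    obtain ⟨h, K, hh, hhc, hK, hK0, hKi, hK1, hKε⟩ :=
      exists_hasCompactSupport_fourier_concentrated hε hε
    have hI : Tendsto (fun y : ℝ ↦ ∫ u, b u * K (u - y)) atTop (𝓝 0) := by
      have := hlim h hh hhc (by rw [funext hK]; exact hKi.ofReal)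
      simp_rw [hK, ← Complex.ofReal_mul, integral_complex_ofReal] at this
      simpa using! (Complex.continuous_re.tendsto 0).comp this
    have hev : ∀ᶠ y in atTop, ε ≤ y ∧ |∫ u, b u * K (u - y)| < ε :=
      (eventually_ge_atTop ε).and (by simpa using hI.abs.eventually_lt_const (by simpa using hε))
    filter_upwards [(tendsto_atTop_add_const_right atTop ε tendsto_id).eventually hev,
      (tendsto_atTop_add_const_right atTop (-ε) tendsto_id).eventually hev] with z hz1 hz2
    simp only [id] at hz1 hz2
    have h1 := (le_integral_kernel_of_monotone ha0 haC ham hb hb0 hbm hK0 hKi hK1 hz1.1).1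
    have h2 := (le_integral_kernel_of_monotone ha0 haC ham hb hb0 hbm hK0 hKi hK1 hz2.1).2
    rw [add_sub_cancel_right] at h1
    rw [neg_add_cancel_right] at h2
    have h3 := (abs_lt.1 hz1.2).2
    have h4 := (abs_lt.1 hz2.2).1
    set m := ∫ u in Set.Icc (-ε) ε, K u
    constructor
    · rw [le_div_iff₀ (by linarith)]
      have h5 : a z * Real.exp (-(2 * ε)) * (1 - ε) ≤ 1 + ε := by
        have := mul_le_mul_of_nonneg_left hKε.le (mul_nonneg (ha0 z) (Real.exp_pos (-(2 * ε))).le)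
        linarith
      calc a z * (1 - ε) = Real.exp (2 * ε) * (a z * Real.exp (-(2 * ε)) * (1 - ε)) := by
            rw [Real.exp_neg]; field_simp
        _ ≤ _ := by gcongr
    · have h5 : 1 - (C + 2) * ε ≤ a z * Real.exp (2 * ε) := by nlinarith
      calc _ ≤ a z * Real.exp (2 * ε) * Real.exp (-(2 * ε)) := by gcongr
        _ = a z := by rw [mul_assoc, ← Real.exp_add]; simp
  have hε : ∀ᶠ ε : ℝ in 𝓝[>] 0, 0 < ε ∧ ε < 1 := Ioo_mem_nhdsGT one_pos
  have hU : Tendsto (fun ε : ℝ ↦ Real.exp (2 * ε) * (1 + ε) / (1 - ε)) (𝓝[>] 0) (𝓝 1) := by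
    have : ContinuousAt (fun ε : ℝ ↦ Real.exp (2 * ε) * (1 + ε) / (1 - ε)) 0 := by
      refine ContinuousAt.div (by fun_prop) (by fun_prop) (by norm_num)
    simpa using this.tendsto.mono_left nhdsWithin_le_nhds
  have hL : Tendsto (fun ε : ℝ ↦ (1 - (C + 2) * ε) * Real.exp (-(2 * ε))) (𝓝[>] 0) (𝓝 1) := by
    have : ContinuousAt (fun ε : ℝ ↦ (1 - (C + 2) * ε) * Real.exp (-(2 * ε))) 0 := by fun_prop
    simpa using this.tendsto.mono_left nhdsWithin_le_nhds
  refine tendsto_order.2 ⟨fun c hc ↦ ?_, fun c hc ↦ ?_⟩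
  · obtain ⟨ε, ⟨h0, h1⟩, h2⟩ := (hε.and (hL.eventually_const_lt hc)).exists
    exact (step ε h0 h1).mono fun z hz ↦ h2.trans_le hz.2
  · obtain ⟨ε, ⟨h0, h1⟩, h2⟩ := (hε.and (hU.eventually_lt_const hc)).exists
    exact (step ε h0 h1).mono fun z hz ↦ hz.1.trans_lt h2

end Tauberian

open ArithmeticFunction.vonMangoldt in
/-- The negative logarithmic derivative of the Riemann zeta function minus its pole at one extends
continuously to the closed half plane. -/
theorem exists_continuousOn_eq_LSeries_vonMangoldt_sub :
    ∃ G : ℂ → ℂ, ContinuousOn G {s | 1 ≤ s.re} ∧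
      ∀ s : ℂ, 1 < s.re → G s = LSeries (fun n ↦ (Λ n : ℂ)) s - 1 / (s - 1) := by
  refine ⟨LFunctionResidueClassAux (1 : ZMod 1), continuousOn_LFunctionResidueClassAux _,
    fun s hs ↦ ?_⟩
  have h1 : residueClass (1 : ZMod 1) = fun n ↦ Λ n := by
    ext n
    simp [residueClass, Set.indicator, Subsingleton.elim (n : ZMod 1) 1]
  rw [eqOn_LFunctionResidueClassAux isUnit_one hs]
  simp [h1]

theorem LSeries_vonMangoldt_eq_mul_integral_psi {s : ℂ} (hs : 1 < s.re) :
    LSeries (fun n ↦ (Λ n : ℂ)) s =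
      s * ∫ t in Set.Ioi (1 : ℝ), (Chebyshev.psi t : ℂ) * (t : ℂ) ^ (-(s + 1)) := by
  rw [LSeries_eq_mul_integral_of_nonneg _ zero_le_one hs ?_
    fun _ ↦ ArithmeticFunction.vonMangoldt_nonneg]
  · congr 1
    refine integral_congr_ae (.of_forall fun t ↦ ?_)
    simp [Chebyshev.psi, ← Finset.Icc_add_one_left_eq_Ioc]
  · refine Asymptotics.IsBigO.of_bound (Real.log 4 + 4) (.of_forall fun n ↦ ?_)
    have h1 : ∑ k ∈ Finset.Icc 1 n, Λ k = Chebyshev.psi n := by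
      simp [Chebyshev.psi, ← Finset.Icc_add_one_left_eq_Ioc]
    rw [h1, Real.norm_of_nonneg (Chebyshev.psi_nonneg _)]
    simpa using Chebyshev.psi_le_const_mul_self n.cast_nonneg

theorem hasMellin_psi_inv {s : ℂ} (hs : 1 < s.re) :
    HasMellin (fun t ↦ (Chebyshev.psi t⁻¹ : ℂ)) s (LSeries (fun n ↦ (Λ n : ℂ)) s / s) := by
  have hs' : 0 < (s + (-1)).re := by simpa using hs
  constructor
  · have h1 := MellinConvergent.const_smul (hasMellin_cpow_Ioc (-1) hs').1
      ((Real.log 4 + 4 : ℝ) : ℂ)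
    rw [MellinConvergent, IntegrableOn] at h1 ⊢
    refine h1.mono ?_ ?_
    · refine AEStronglyMeasurable.smul (f := fun t : ℝ ↦ (t : ℂ) ^ (s - 1)) ?_ ?_
      · refine ContinuousOn.aestronglyMeasurable (fun t ht ↦ ?_) measurableSet_Ioi
        exact (Complex.continuousAt_ofReal_cpow_const _ _
          (.inr (ne_of_gt ht))).continuousWithinAt
      · exact (Complex.measurable_ofReal.comp
          (Chebyshev.psi_mono.measurable.comp measurable_inv)).aestronglyMeasurable
    · refine (ae_restrict_mem measurableSet_Ioi).mono fun t (ht : 0 < t) ↦ ?_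
      rw [norm_smul, norm_smul]
      gcongr
      rcases le_or_gt t 1 with h | h
      · rw [Set.indicator_of_mem (show t ∈ Set.Ioc (0 : ℝ) 1 from ⟨ht, h⟩), Complex.cpow_neg_one, smul_eq_mul, norm_mul,
          Complex.norm_real, Complex.norm_real, ← Complex.ofReal_inv, Complex.norm_real,
          Real.norm_of_nonneg (Chebyshev.psi_nonneg _), Real.norm_of_nonneg (by positivity),
          Real.norm_of_nonneg (by positivity)]
        exact Chebyshev.psi_le_const_mul_self (by positivity)
      · rw [Chebyshev.psi_eq_zero_of_le_one (inv_le_one_of_one_le₀ h.le), Complex.ofReal_zero, norm_zero]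
        positivity
  · have hs0 : s ≠ 0 := by rintro rfl; norm_num at hs
    rw [mellin_comp_inv (fun t ↦ (Chebyshev.psi t : ℂ)), LSeries_vonMangoldt_eq_mul_integral_psi hs,
      mul_div_cancel_left₀ _ hs0, mellin]
    rw [← setIntegral_eq_of_subset_of_forall_sdiff_eq_zero measurableSet_Ioi
      (Set.Ioi_subset_Ioi zero_le_one)]
    · refine integral_congr_ae (.of_forall fun t ↦ ?_)
      simp only [smul_eq_mul]
      rw [mul_comm]
      ring_nf
    · intro t ht
      simp [Chebyshev.psi_eq_zero_of_le_one (not_lt.1 ht.2)]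

/-- The normalised error term in the prime number theorem, on a logarithmic scale. -/
noncomputable def psiError (u : ℝ) : ℝ :=
  if 0 ≤ u then Chebyshev.psi (Real.exp u) * Real.exp (-u) - 1 else 0

theorem fourier_exp_mul_psiError {σ : ℝ} (hσ : 0 < σ) (ξ : ℝ) :
    𝓕 (fun u : ℝ ↦ (Real.exp (-σ * u) : ℂ) * (psiError u : ℂ)) ξ =
      LSeries (fun n ↦ (Λ n : ℂ)) (1 + (σ + 2 * Real.pi * ξ * Complex.I)) /
        (1 + (σ + 2 * Real.pi * ξ * Complex.I)) - 1 / (σ + 2 * Real.pi * ξ * Complex.I) := by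
  set s : ℂ := 1 + (σ + 2 * Real.pi * ξ * Complex.I) with hs
  have hre : s.re = 1 + σ := by simp [hs]
  have him : s.im = 2 * Real.pi * ξ := by simp [hs]
  have h1 : 1 < s.re := by linarith
  have h2 := (hasMellin_sub (hasMellin_psi_inv h1).1 (hasMellin_cpow_Ioc (-1) (s := s)
    (by simpa using h1)).1).2
  rw [(hasMellin_psi_inv h1).2, (hasMellin_cpow_Ioc (-1) (s := s) (by simpa using h1)).2,
    mellin_eq_fourier, him, hre, mul_div_cancel_left₀ _ (by positivity)] at h2
  rw [show (σ + 2 * Real.pi * ξ * Complex.I : ℂ) = s + -1 by rw [hs]; ring, ← h2]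
  refine Real.fourier_congr_ae (.of_forall fun u ↦ ?_) ξ
  rcases le_or_gt 0 u with hu | hu
  · rw [Set.indicator_of_mem (show Real.exp (-u) ∈ Set.Ioc (0 : ℝ) 1 from
      ⟨Real.exp_pos _, Real.exp_le_one_iff.2 (by linarith)⟩), psiError,
      if_pos hu, Complex.cpow_neg_one, Real.exp_neg u, inv_inv, Complex.real_smul]
    rw [show -(1 + σ) * u = -σ * u + -u by ring, Real.exp_add, Real.exp_neg u]
    push_cast
    field_simp
  · rw [Set.indicator_of_notMem, psiError, if_neg hu.not_ge, ← Real.exp_neg, neg_neg,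
      Chebyshev.psi_eq_zero_of_le_one (Real.exp_le_one_iff.2 hu.le)]
    · simp
    · simp [hu]

theorem isLittleO_div_log_sq_div_log :
    (fun x : ℝ ↦ x / Real.log x ^ 2) =o[atTop] (fun x ↦ x / Real.log x) := by
  refine (isLittleO_iff_tendsto' (by simp)).2 ?_
  refine Real.tendsto_log_atTop.inv_tendsto_atTop.congr' ?_
  filter_upwards [eventually_gt_atTop 1] with x hx
  have := Real.log_pos hx
  simp only [Pi.inv_apply]
  field

theorem isLittleO_sqrt_id : Real.sqrt =o[atTop] (id : ℝ → ℝ) := by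
  refine (isLittleO_iff_tendsto' ?_).2 ?_
  · filter_upwards [eventually_gt_atTop 0] with x hx h
    exact absurd h hx.ne'
  · simpa [Real.sqrt_div_self'] using! Real.tendsto_sqrt_atTop.inv_tendsto_atTop

theorem theta_isEquivalent_of_psi (h : Chebyshev.psi ~[atTop] id) : Chebyshev.theta ~[atTop] id := by
  have : (Chebyshev.psi - Chebyshev.theta) =o[atTop] (id : ℝ → ℝ) :=
    Chebyshev.isBigO_psi_sub_theta_sqrt.trans_isLittleO isLittleO_sqrt_id
  simpa using h.sub_isLittleO this

theorem primeCounting_isEquivalent_of_theta (h : Chebyshev.theta ~[atTop] id) :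
    (fun x : ℝ ↦ (Nat.primeCounting ⌊x⌋₊ : ℝ)) ~[atTop] fun x ↦ x / Real.log x := by
  have h1 : (fun x ↦ Chebyshev.theta x / Real.log x) ~[atTop] fun x ↦ x / Real.log x :=
    h.div IsEquivalent.refl
  have h2 := Chebyshev.primeCounting_sub_theta_div_log_isBigO.trans_isLittleO
    isLittleO_div_log_sq_div_log
  refine (h1.add_isLittleO h2).congr_left (.of_forall fun x ↦ ?_)
  simp

theorem integral_one_div_log_eq {x : ℝ} (hx : 2 ≤ x) :
    ∫ t in (2 : ℝ)..x, 1 / Real.log t =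
      x / Real.log x - 2 / Real.log 2 + ∫ t in (2 : ℝ)..x, 1 / Real.log t ^ 2 := by
  have hlog : ∀ t ∈ Set.uIcc 2 x, t ≠ 0 ∧ Real.log t ≠ 0 := fun t ht ↦ by
    rw [Set.uIcc_of_le hx] at ht
    exact ⟨by linarith [ht.1], (Real.log_pos (by linarith [ht.1])).ne'⟩
  have hi2 := Chebyshev.intervalIntegrable_one_div_log_sq (a := 2) (b := x) (by norm_num)
    (by linarith)
  have hi1 : IntervalIntegrable (fun t ↦ 1 / Real.log t) MeasureTheory.volume 2 x := by
    refine ContinuousOn.intervalIntegrable fun t ht ↦ ContinuousAt.continuousWithinAt ?_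
    exact continuousAt_const.div (Real.continuousAt_log (hlog t ht).1) (hlog t ht).2
  have hd : ∀ t ∈ Set.uIcc 2 x, HasDerivAt (fun t ↦ t / Real.log t)
      (1 / Real.log t - 1 / Real.log t ^ 2) t := fun t ht ↦ by
    have h := (hasDerivAt_id t).div (Real.hasDerivAt_log (hlog t ht).1) (hlog t ht).2
    convert! h using 1
    have := hlog t ht
    simp only [id, one_mul, mul_inv_cancel₀ this.1]
    field_simp
  have := intervalIntegral.integral_eq_sub_of_hasDerivAt hd (hi1.sub hi2)
  rw [intervalIntegral.integral_sub hi1 hi2] at this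
  linarith

theorem integral_one_div_log_isEquivalent :
    (fun x : ℝ ↦ ∫ t in (2 : ℝ)..x, 1 / Real.log t) ~[atTop] fun x ↦ x / Real.log x := by
  have h1 := Chebyshev.integral_one_div_log_sq_isBigO.trans_isLittleO isLittleO_div_log_sq_div_log
  have h2 : (fun _ : ℝ ↦ -(2 / Real.log 2)) =o[atTop] fun x ↦ x / Real.log x := by
    refine (isLittleO_iff_tendsto' ?_).2 ?_
    · filter_upwards [eventually_gt_atTop 1] with x hx h
      have := Real.log_pos hx
      have : 0 < x / Real.log x := by positivity
      exact absurd h this.ne'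
    · have := Real.isLittleO_log_id_atTop.tendsto_div_nhds_zero.const_mul (-(2 / Real.log 2))
      simpa [div_eq_mul_inv, mul_comm] using this
  refine ((IsEquivalent.refl.add_isLittleO h2).add_isLittleO h1).congr_left ?_
  filter_upwards [eventually_ge_atTop 2] with x hx
  rw [integral_one_div_log_eq hx]
  simp [sub_eq_add_neg]

theorem psi_exp_mul_exp_neg_le (u : ℝ) :
    Chebyshev.psi (Real.exp u) * Real.exp (-u) ≤ Real.log 4 + 4 := by
  rw [Real.exp_neg, ← div_eq_mul_inv, div_le_iff₀ (Real.exp_pos u)]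
  exact Chebyshev.psi_le_const_mul_self (Real.exp_pos u).le

theorem measurable_psiError : Measurable psiError := by
  unfold psiError
  have := Chebyshev.psi_mono.measurable
  exact Measurable.ite measurableSet_Ici (by fun_prop) measurable_const

theorem abs_psiError_le (u : ℝ) : |psiError u| ≤ Real.log 4 + 4 := by
  have h1 := psi_exp_mul_exp_neg_le u
  have h2 : 0 ≤ Chebyshev.psi (Real.exp u) * Real.exp (-u) :=
    mul_nonneg (Chebyshev.psi_nonneg _) (Real.exp_pos _).le
  have h3 : 0 ≤ Real.log 4 := Real.log_nonneg (by norm_num)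
  rw [psiError]
  split_ifs
  · exact abs_le.2 ⟨by linarith, by linarith⟩
  · rw [abs_zero]
    positivity

theorem tendsto_integral_psiError_mul_fourier {h : ℝ → ℂ} (hh : Continuous h)
    (hhc : HasCompactSupport h) (hFh : Integrable (𝓕 h)) :
    Tendsto (fun y : ℝ ↦ ∫ u, (psiError u : ℂ) * 𝓕 h (u - y)) atTop (𝓝 0) := by
  obtain ⟨G, hG, hGeq⟩ := exists_continuousOn_eq_LSeries_vonMangoldt_sub
  have hre : ∀ s ∈ {s : ℂ | 0 ≤ s.re}, 1 + s ≠ 0 := fun s (hs : 0 ≤ s.re) h0 ↦ by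
    have := congrArg Complex.re h0
    simp only [Complex.add_re, Complex.one_re, Complex.zero_re] at this
    linarith
  refine tendsto_integral_mul_fourier_sub (C := Real.log 4 + 4)
    (G := fun s ↦ (G (1 + s) - 1) / (1 + s)) (Complex.measurable_ofReal.comp measurable_psiError)
    (fun u ↦ by simpa using abs_psiError_le u) (fun u hu ↦ by simp [psiError, hu.not_ge]) ?_ ?_
    hh hhc hFh
  · refine ContinuousOn.div (ContinuousOn.sub ?_ continuousOn_const) (by fun_prop) hre
    exact hG.comp (by fun_prop) fun s (hs : 0 ≤ s.re) ↦ by simpa using hs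
  · intro σ hσ ξ
    rw [fourier_exp_mul_psiError hσ]
    set s : ℂ := σ + 2 * Real.pi * ξ * Complex.I with hs
    have hsre : s.re = σ := by simp [hs]
    have h0 : s ≠ 0 := fun h ↦ by simp [h] at hsre; linarith
    have h1 : 1 + s ≠ 0 := hre s (by simp [hsre, hσ.le])
    rw [hGeq (1 + s) (by simp [hsre, hσ])]
    rw [add_sub_cancel_left]
    field_simp
    ring

/-- The prime number theorem for the second Chebyshev function. -/
theorem psi_isEquivalent_id : Chebyshev.psi ~[atTop] id := by
  have h := tendsto_one_of_integral_fourier_kernel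
    (a := fun u ↦ Chebyshev.psi (Real.exp u) * Real.exp (-u)) (b := psiError)
    (fun u ↦ mul_nonneg (Chebyshev.psi_nonneg _) (Real.exp_pos _).le) psi_exp_mul_exp_neg_le
    (fun u v huv ↦ by
      simp only [mul_assoc, ← Real.exp_add, neg_add_cancel, Real.exp_zero, mul_one]
      exact Chebyshev.psi_mono (Real.exp_le_exp.2 huv))
    (fun u hu ↦ if_pos hu) (fun u hu ↦ if_neg hu.not_ge) measurable_psiError
    fun h hh hhc hFh ↦ tendsto_integral_psiError_mul_fourier hh hhc hFh
  refine (isEquivalent_iff_tendsto_one ?_).2 ?_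
  · filter_upwards [eventually_ne_atTop 0] with x hx using hx
  · refine (h.comp Real.tendsto_log_atTop).congr' ?_
    filter_upwards [eventually_gt_atTop 0] with x hx
    simp [Real.exp_neg, Real.exp_log hx, div_eq_mul_inv]

theorem prime_number_theorem_li :
    Tendsto (fun x : ℝ =>
        (Nat.primeCounting ⌊x⌋₊ : ℝ) / ∫ t in (2 : ℝ)..x, 1 / Real.log t)
      atTop (nhds 1) := by
  have hequiv := (primeCounting_isEquivalent_of_theta
    (theta_isEquivalent_of_psi psi_isEquivalent_id)).trans integral_one_div_log_isEquivalent.symm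
  refine (isEquivalent_iff_tendsto_one ?_).1 hequiv
  filter_upwards [eventually_gt_atTop 2] with x hx
  refine (intervalIntegral.intervalIntegral_pos_of_pos_on ?_ (fun t ht ↦ ?_) hx).ne'
  · refine ContinuousOn.intervalIntegrable fun t ht ↦ ContinuousAt.continuousWithinAt ?_
    rw [Set.uIcc_of_le hx.le] at ht
    exact continuousAt_const.div (Real.continuousAt_log (by linarith [ht.1]))
      (Real.log_pos (by linarith [ht.1])).ne'
  · exact one_div_pos.2 (Real.log_pos (by linarith [ht.1]))
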